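/- arXiv:2211.01932 — 2 statements merged into one kernel-verified Lean document; each statement's English description precedes it below -/
import Mathlib

section
/- Fix an integer n ≥ 1 and suppose that for every j, k ∈ {1,…,n} the coefficients β^n_j, γ^n_j, A^n_{jk} : [0,∞) → ℝ are measurable, essentially bounded, and nonnegative almost everywhere. Then for every initial datum (s^n_{j,0}, i^n_{j,0}, r^n_{j,0})_{j=1,…,n} satisfying 0 ≤ s^n_{j,0}, i^n_{j,0}, r^n_{j,0} ≤ 1 and s^n_{j,0} + i^n_{j,0} + r^n_{j,0} = 1 for every j, the graph SIR system admits exactly one global solution (s^n_j, i^n_j, r^n_j)_{j=1,…,n} : [0,∞) → ℝ^{3n} attaining this datum at t = 0. -/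
open MeasureTheory Real Filter Set

noncomputable section

/-- The subinterval `I^n_j = (j/n, (j+1)/n)` of `(0,1)`, for `j : Fin n`
(corresponding to `((j-1)/n, j/n)` in one-based indexing). -/
def Inj (n : ℕ) (j : Fin n) : Set ℝ := Set.Ioo ((j : ℝ) / n) (((j : ℝ) + 1) / n)

/-- Step function on `[0,1]` associated with a vector `v : Fin n → ℝ`. -/
def stepFn (n : ℕ) (v : Fin n → ℝ) (x : ℝ) : ℝ :=
  ∑ j : Fin n, Set.indicator (Inj n j) (fun _ => v j) x

/-- Step kernel (step graphon) on `[0,1]²` associated with a matrix. -/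
def stepKer (n : ℕ) (A : Fin n → Fin n → ℝ) (x y : ℝ) : ℝ :=
  ∑ j : Fin n, ∑ k : Fin n,
    Set.indicator (Inj n j) (fun _ => Set.indicator (Inj n k) (fun _ => A j k) y) x

/-- Average `⟨u⟩_{I^n_j} = n ∫_{I^n_j} u`. -/
def avg1 (n : ℕ) (j : Fin n) (u : ℝ → ℝ) : ℝ := (n : ℝ) * ∫ x in Inj n j, u x

/-- Average `⟨U⟩_{I^n_j × I^n_k} = n² ∬_{I^n_j × I^n_k} U`. -/
def avg2 (n : ℕ) (j k : Fin n) (U : ℝ → ℝ → ℝ) : ℝ :=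
  (n : ℝ) ^ 2 * ∫ x in Inj n j, ∫ y in Inj n k, U x y

/-- Carathéodory (integral-form) solutions of the graph SIR system on a time set `J`. -/
def IsGraphSIRSol (n : ℕ) (J : Set ℝ) (β γ : Fin n → ℝ → ℝ)
    (A : Fin n → Fin n → ℝ → ℝ) (s i r : Fin n → ℝ → ℝ) : Prop :=
  (∀ j : Fin n, ContinuousOn (s j) J ∧ ContinuousOn (i j) J ∧ ContinuousOn (r j) J) ∧
  ∀ j : Fin n, ∀ t ∈ J,
    (s j t = s j 0 - ∫ τ in (0:ℝ)..t,
        s j τ * (1 / (n : ℝ) * ∑ k : Fin n, β k τ * A j k τ * i k τ)) ∧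
    (i j t = i j 0 + ∫ τ in (0:ℝ)..t,
        (s j τ * (1 / (n : ℝ) * ∑ k : Fin n, β k τ * A j k τ * i k τ) - γ j τ * i j τ)) ∧
    (r j t = r j 0 + ∫ τ in (0:ℝ)..t, γ j τ * i j τ)

/-- Smooth test functions on `[0,T) × [0,1]` (vanishing for `t` close to `T`). -/
def IsTest (T : ℝ) (φ : ℝ → ℝ → ℝ) : Prop :=
  ContDiff ℝ (⊤ : ℕ∞) (fun p : ℝ × ℝ => φ p.1 p.2) ∧ ∃ T' : ℝ, T' < T ∧ ∀ t x : ℝ, T' ≤ t → φ t x = 0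

/-- Distributional solutions of the continuum SIR system on `[0,T] × [0,1]`
with kernel `W`, coefficients `β, γ` and initial data `(s₀, i₀, r₀)`. -/
def IsDistribSol (T : ℝ) (W : ℝ → ℝ → ℝ → ℝ) (β γ : ℝ → ℝ → ℝ)
    (s0 i0 r0 : ℝ → ℝ) (s i r : ℝ → ℝ → ℝ) : Prop :=
  Measurable (fun p : ℝ × ℝ => s p.1 p.2) ∧
  Measurable (fun p : ℝ × ℝ => i p.1 p.2) ∧
  Measurable (fun p : ℝ × ℝ => r p.1 p.2) ∧
  (∀ φ : ℝ → ℝ → ℝ, IsTest T φ →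
    (∫ t in Set.Icc (0:ℝ) T, ∫ x in Set.Icc (0:ℝ) 1,
        s t x * (deriv (fun τ => φ τ x) t
          - φ t x * ∫ y in Set.Icc (0:ℝ) 1, β t y * W t x y * i t y))
      + (∫ x in Set.Icc (0:ℝ) 1, s0 x * φ 0 x) = 0) ∧
  (∀ ψ : ℝ → ℝ → ℝ, IsTest T ψ →
    (∫ t in Set.Icc (0:ℝ) T, ∫ x in Set.Icc (0:ℝ) 1,
        (i t x * (deriv (fun τ => ψ τ x) t - γ t x * ψ t x)
          + s t x * ψ t x * ∫ y in Set.Icc (0:ℝ) 1, β t y * W t x y * i t y))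
      + (∫ x in Set.Icc (0:ℝ) 1, i0 x * ψ 0 x) = 0) ∧
  (∀ η : ℝ → ℝ → ℝ, IsTest T η →
    (∫ t in Set.Icc (0:ℝ) T, ∫ x in Set.Icc (0:ℝ) 1,
        (r t x * deriv (fun τ => η τ x) t + γ t x * η t x * i t x))
      + (∫ x in Set.Icc (0:ℝ) 1, r0 x * η 0 x) = 0)

/-- The cut norm of a kernel on `[0,1]²`. -/
def cutNorm (U : ℝ → ℝ → ℝ) : ℝ :=
  sSup { c : ℝ | ∃ S T : Set ℝ, MeasurableSet S ∧ MeasurableSet T ∧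
    S ⊆ Set.Icc 0 1 ∧ T ⊆ Set.Icc 0 1 ∧ c = |∫ x in S, ∫ y in T, U x y| }

/-- `L²(0,1)` distance. -/
def L2dist (f g : ℝ → ℝ) : ℝ := Real.sqrt (∫ x in Set.Icc (0:ℝ) 1, (f x - g x) ^ 2)

/-- `L¹(0,1)` distance. -/
def L1dist (f g : ℝ → ℝ) : ℝ := ∫ x in Set.Icc (0:ℝ) 1, |f x - g x|


lemma aux_exists_car {E : Type*} [NormedAddCommGroup E] [NormedSpace ℝ E] [CompleteSpace E]
    (F : ℝ → E → E) (K M : ℝ) (hK : 0 < K) (hLip : ∀ t x y, ‖F t x - F t y‖ ≤ K * ‖x - y‖)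
    (hM : ∀ t x, ‖F t x‖ ≤ M)
    (hmeas : ∀ u : ℝ → E, Continuous u → AEStronglyMeasurable (fun t => F t (u t)) volume)
    (x0 : E) :
    ∃ u : ℝ → E, Continuous u ∧ ∀ t, 0 ≤ t → u t = x0 + ∫ τ in (0:ℝ)..t, F τ (u τ) := by
  have hint : ∀ u : ℝ → E, Continuous u → ∀ a b : ℝ,
      IntervalIntegrable (fun t => F t (u t)) volume a b := by
    intro u hu a b
    refine (intervalIntegrable_const (c := M)).mono_fun (hmeas u hu).restrict ?_
    refine Eventually.of_forall fun t => ?_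
    exact (hM t _).trans (le_abs_self M)
  have hM0 : 0 ≤ M := (norm_nonneg _).trans (hM 0 0)
  let L : ℝ := 2 * K
  have hL : 0 < L := by positivity
  let lift : (BoundedContinuousFunction ℝ E) → ℝ → E := fun v τ => Real.exp (L * τ) • v τ
  have hlift : ∀ v, Continuous (lift v) := by
    intro v
    have := v.continuous
    fun_prop
  let P : (BoundedContinuousFunction ℝ E) → ℝ → E := fun v t =>
    Real.exp (-(L * max t 0)) • (x0 + ∫ τ in (0:ℝ)..(max t 0), F τ (lift v τ))
  have hPc : ∀ v, Continuous (P v) := by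
    intro v
    have h1 : Continuous fun t : ℝ => ∫ τ in (0:ℝ)..t, F τ (lift v τ) :=
      intervalIntegral.continuous_primitive (hint _ (hlift v)) 0
    have h2 : Continuous fun t : ℝ => ∫ τ in (0:ℝ)..(max t 0), F τ (lift v τ) :=
      h1.comp (continuous_id.max continuous_const)
    exact (by fun_prop : Continuous fun t : ℝ => Real.exp (-(L * max t 0))).smul
      (continuous_const.add h2)
  have hPb : ∀ v t, ‖P v t‖ ≤ ‖x0‖ + M / L := by
    intro v t
    have ht : 0 ≤ max t 0 := le_max_right _ _
    simp only [P]
    generalize max t 0 = s at ht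
    rw [norm_smul, Real.norm_of_nonneg (Real.exp_pos _).le]
    have h1 : ‖∫ τ in (0:ℝ)..s, F τ (lift v τ)‖ ≤ M * |s - 0| :=
      intervalIntegral.norm_integral_le_of_norm_le_const fun τ _ => hM τ _
    rw [sub_zero, abs_of_nonneg ht] at h1
    have h2 : L * s + 1 ≤ Real.exp (L * s) := Real.add_one_le_exp _
    have h3 := norm_add_le x0 (∫ τ in (0:ℝ)..s, F τ (lift v τ))
    rw [Real.exp_neg, inv_mul_le_iff₀ (Real.exp_pos _)]
    have h4 : M * s = M / L * (L * s) := by field_simp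
    have h5 : 0 ≤ M / L := by positivity
    have h6 : 0 ≤ L * s := by positivity
    nlinarith [norm_nonneg x0]
  let Φ : BoundedContinuousFunction ℝ E → BoundedContinuousFunction ℝ E := fun v =>
    BoundedContinuousFunction.ofNormedAddCommGroup (P v) (hPc v) _ (hPb v)
  have hΦ : ∀ v t, Φ v t = P v t := fun v t => rfl
  have hcontr : ContractingWith (1/2 : NNReal) Φ := by
    refine ⟨by rw [← NNReal.coe_lt_coe]; norm_num, LipschitzWith.of_dist_le_mul fun v w => ?_⟩
    rw [BoundedContinuousFunction.dist_le (by positivity)]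
    intro t
    rw [hΦ, hΦ, dist_eq_norm]
    have ht : 0 ≤ max t 0 := le_max_right _ _
    simp only [P]
    generalize max t 0 = s at ht
    rw [← smul_sub, add_sub_add_left_eq_sub,
      ← intervalIntegral.integral_sub (hint _ (hlift v) _ _) (hint _ (hlift w) _ _),
      norm_smul, Real.norm_of_nonneg (Real.exp_pos _).le,
      Real.exp_neg, inv_mul_le_iff₀ (Real.exp_pos _)]
    have h1 : ‖∫ τ in (0:ℝ)..s, (F τ (lift v τ) - F τ (lift w τ))‖
        ≤ ∫ τ in (0:ℝ)..s, K * dist v w * Real.exp (L * τ) := by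
      refine intervalIntegral.norm_integral_le_of_norm_le ht ?_
        (Continuous.intervalIntegrable (by fun_prop) _ _)
      refine Eventually.of_forall fun τ _ => ?_
      refine (hLip _ _ _).trans ?_
      simp only [lift]
      rw [← smul_sub, norm_smul, Real.norm_of_nonneg (Real.exp_pos _).le, ← dist_eq_norm]
      have := BoundedContinuousFunction.dist_coe_le_dist (f := v) (g := w) τ
      have h3 : Real.exp (L * τ) * dist (v τ) (w τ) ≤ Real.exp (L * τ) * dist v w := by gcongr
      nlinarith
    refine h1.trans ?_
    rw [intervalIntegral.integral_const_mul, intervalIntegral.integral_comp_mul_left (fun x => Real.exp x) hL.ne',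
      integral_exp]
    simp only [L, smul_eq_mul, mul_zero, Real.exp_zero]
    push_cast
    have h4 : K * dist v w * ((2 * K)⁻¹ * (Real.exp (2 * K * s) - 1))
      = 1 / 2 * dist v w * (Real.exp (2 * K * s) - 1) := by field_simp
    rw [h4]
    nlinarith [dist_nonneg (x := v) (y := w)]
  set v := hcontr.fixedPoint Φ with hv
  have hfix : Φ v = v := hcontr.fixedPoint_isFixedPt
  refine ⟨lift v, hlift v, fun t ht => ?_⟩
  have h1 : v t = P v t := by rw [← hΦ, hfix]
  change Real.exp (L * t) • v t = _
  rw [h1]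
  simp only [P, max_eq_left ht]
  rw [smul_smul, ← Real.exp_add]
  simp

lemma aux_nonneg (f h : ℝ → ℝ) (hf : Continuous f)
    (hh : ∀ a b : ℝ, IntervalIntegrable h volume a b)
    (hfh : ∀ t, 0 ≤ t → f t = f 0 + ∫ τ in (0:ℝ)..t, h τ) (h0 : 0 ≤ f 0)
    (hneg : ∀ τ, f τ < 0 → 0 ≤ h τ) : ∀ t, 0 ≤ t → 0 ≤ f t := by
  intro t1 ht1
  by_contra hlt
  push Not at hlt
  let S : Set ℝ := Icc 0 t1 ∩ {t | 0 ≤ f t}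
  have hS : IsCompact S := isCompact_Icc.inter_right (isClosed_le continuous_const hf)
  have hne : S.Nonempty := ⟨0, ⟨le_rfl, ht1⟩, h0⟩
  have hmem := hS.sSup_mem hne
  set t0 := sSup S
  obtain ⟨⟨h00, h01⟩, hft0⟩ := hmem
  have hI : f t1 - f t0 = ∫ τ in t0..t1, h τ := by
    rw [hfh t1 ht1, hfh t0 h00, add_sub_add_left_eq_sub,
      intervalIntegral.integral_interval_sub_left (hh _ _) (hh _ _)]
  have hI2 : 0 ≤ ∫ τ in t0..t1, h τ := by
    rw [intervalIntegral.integral_of_le h01]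
    refine setIntegral_nonneg measurableSet_Ioc fun τ hτ => hneg τ ?_
    by_contra hc
    push Not at hc
    have : τ ≤ t0 := le_csSup hS.bddAbove ⟨⟨h00.trans hτ.1.le, hτ.2⟩, hc⟩
    exact absurd hτ.1 (not_lt.mpr this)
  have : 0 ≤ f t0 := hft0
  linarith

lemma aux_gronwall (g : ℝ → ℝ) (hg : Continuous g) (hg0 : ∀ t, 0 ≤ g t) (K T : ℝ) 
    (h : ∀ t ∈ Icc 0 T, g t ≤ K * ∫ τ in (0:ℝ)..t, g τ) : ∀ t ∈ Icc 0 T, g t = 0 := by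
  have hd : ∀ x, HasDerivAt (fun t => ∫ τ in (0:ℝ)..t, g τ) (g x) x := fun x =>
    intervalIntegral.integral_hasDerivAt_right (hg.intervalIntegrable _ _)
      (hg.stronglyMeasurableAtFilter _ _) hg.continuousAt
  have hG := eq_zero_of_abs_deriv_le_mul_abs_self_of_eq_zero_right
    (f := fun t => ∫ τ in (0:ℝ)..t, g τ) (f' := g) (K := K) (a := 0) (b := T)
    (fun x _ => (hd x).continuousAt.continuousWithinAt)
    (fun x _ => (hd x).hasDerivWithinAt) (by simp) (by
      intro x hx
      have h0 : 0 ≤ ∫ τ in (0:ℝ)..x, g τ :=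
        intervalIntegral.integral_nonneg hx.1 fun u _ => hg0 u
      rw [Real.norm_of_nonneg (hg0 x), Real.norm_of_nonneg h0]
      exact h x ⟨hx.1, hx.2.le⟩)
  intro t ht
  have := h t ht
  have h2 := hG t ht
  rw [h2, mul_zero] at this
  exact le_antisymm this (hg0 t)

def auxCl (x : ℝ) : ℝ := max 0 (min 1 x)

lemma auxCl_nonneg (x : ℝ) : 0 ≤ auxCl x := le_max_left _ _

lemma auxCl_le_one (x : ℝ) : auxCl x ≤ 1 := max_le zero_le_one (min_le_left _ _)

lemma auxCl_of_mem {x : ℝ} (h0 : 0 ≤ x) (h1 : x ≤ 1) : auxCl x = x := by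
  simp [auxCl, h0, h1]

lemma auxCl_of_neg {x : ℝ} (h0 : x < 0) : auxCl x = 0 := by
  simp [auxCl, h0.le]

lemma auxCl_lip (x y : ℝ) : |auxCl x - auxCl y| ≤ |x - y| := by
  unfold auxCl
  refine (abs_max_sub_max_le_max _ _ _ _).trans ?_
  refine max_le (by simp) ((abs_min_sub_min_le_max _ _ _ _).trans (max_le (by simp) le_rfl))

lemma auxCl_cont : Continuous auxCl := by unfold auxCl; fun_prop

lemma aux_bilin (b C a a' c c' R : ℝ) (hb0 : 0 ≤ b) (hbC : b ≤ C) (ha' : |a'| ≤ R)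
    (hc : |c| ≤ R) : |a * (b * c) - a' * (b * c')| ≤ C * R * (|a - a'| + |c - c'|) := by
  have h : a * (b * c) - a' * (b * c') = b * ((a - a') * c + a' * (c - c')) := by ring
  rw [h, abs_mul, abs_of_nonneg hb0, mul_assoc]
  refine mul_le_mul hbC ?_ (abs_nonneg _) (hb0.trans hbC)
  refine (abs_add_le _ _).trans ?_
  rw [abs_mul, abs_mul, mul_add]
  have h1 := mul_le_mul_of_nonneg_left hc (abs_nonneg (a - a'))
  have h2 := mul_le_mul_of_nonneg_right ha' (abs_nonneg (c - c'))
  linarith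

lemma aux_core_exists (n : ℕ) (B : Fin n → Fin n → ℝ → ℝ) (g : Fin n → ℝ → ℝ) (C : ℝ)
    (hBm : ∀ j k, Measurable (B j k)) (hgm : ∀ j, Measurable (g j))
    (hB0 : ∀ j k t, 0 ≤ B j k t) (hBC : ∀ j k t, B j k t ≤ C)
    (hg0 : ∀ j t, 0 ≤ g j t) (hgC : ∀ j t, g j t ≤ C) (hC : 0 ≤ C)
    (s0 i0 r0 : Fin n → ℝ) (hs0 : ∀ j, 0 ≤ s0 j) (hi0 : ∀ j, 0 ≤ i0 j) (hr0 : ∀ j, 0 ≤ r0 j)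
    (hsum : ∀ j, s0 j + i0 j + r0 j = 1) :
    ∃ s i r : Fin n → ℝ → ℝ, (∀ j, Continuous (s j) ∧ Continuous (i j) ∧ Continuous (r j)) ∧
      (∀ j, s j 0 = s0 j ∧ i j 0 = i0 j ∧ r j 0 = r0 j) ∧
      ∀ j t, 0 ≤ t →
        s j t = s0 j - (∫ τ in (0:ℝ)..t, s j τ * ∑ k, B j k τ * i k τ) ∧
        i j t = i0 j + (∫ τ in (0:ℝ)..t, (s j τ * (∑ k, B j k τ * i k τ) - g j τ * i j τ)) ∧
        r j t = r0 j + ∫ τ in (0:ℝ)..t, g j τ * i j τ := by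
  let E := (Fin n → ℝ) × (Fin n → ℝ)
  let a : Fin n → ℝ → E → ℝ := fun j t x => auxCl (x.1 j) * ∑ k, B j k t * auxCl (x.2 k)
  let F : ℝ → E → E := fun t x =>
    (fun j => -(a j t x), fun j => a j t x - g j t * auxCl (x.2 j))
  have ha0 : ∀ j t x, 0 ≤ a j t x := fun j t x =>
    mul_nonneg (auxCl_nonneg _) (Finset.sum_nonneg fun k _ =>
      mul_nonneg (hB0 _ _ _) (auxCl_nonneg _))
  have haC : ∀ j t x, a j t x ≤ n * C := by
    intro j t x
    have h1 : ∑ k, B j k t * auxCl (x.2 k) ≤ n * C := by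
      have : ∑ k, B j k t * auxCl (x.2 k) ≤ ∑ k : Fin n, C * 1 :=
        Finset.sum_le_sum fun k _ => mul_le_mul (hBC _ _ _) (auxCl_le_one _) (auxCl_nonneg _) hC
      simpa using this
    have h0 : 0 ≤ ∑ k, B j k t * auxCl (x.2 k) :=
      Finset.sum_nonneg fun k _ => mul_nonneg (hB0 _ _ _) (auxCl_nonneg _)
    calc a j t x ≤ 1 * (n * C) := mul_le_mul (auxCl_le_one _) h1 h0 zero_le_one
      _ = _ := one_mul _
  have hcl1 : ∀ x, |auxCl x| ≤ 1 := fun x => by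
    rw [abs_of_nonneg (auxCl_nonneg _)]; exact auxCl_le_one _
  have hc1 : ∀ (x y : E) j, |x.1 j - y.1 j| ≤ ‖x - y‖ := fun x y j =>
    (norm_le_pi_norm (x - y).1 j).trans (norm_fst_le (x - y))
  have hc2 : ∀ (x y : E) j, |x.2 j - y.2 j| ≤ ‖x - y‖ := fun x y j =>
    (norm_le_pi_norm (x - y).2 j).trans (norm_snd_le (x - y))
  have haL : ∀ j t x y, |a j t x - a j t y| ≤ n * (2 * C) * ‖x - y‖ := by
    intro j t x y
    simp only [a]
    rw [Finset.mul_sum, Finset.mul_sum, ← Finset.sum_sub_distrib]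
    refine (Finset.abs_sum_le_sum_abs _ _).trans ?_
    have : ∑ k, |auxCl (x.1 j) * (B j k t * auxCl (x.2 k)) -
        auxCl (y.1 j) * (B j k t * auxCl (y.2 k))| ≤ ∑ k : Fin n, (2 * C) * ‖x - y‖ := by
      refine Finset.sum_le_sum fun k _ => ?_
      refine (aux_bilin _ C _ _ _ _ 1 (hB0 j k t) (hBC j k t) (hcl1 _) (hcl1 _)).trans ?_
      have h1 := (auxCl_lip (x.1 j) (y.1 j)).trans (hc1 x y j)
      have h2 := (auxCl_lip (x.2 k) (y.2 k)).trans (hc2 x y k)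
      nlinarith
    refine this.trans (le_of_eq ?_)
    simp; ring
  have hgL : ∀ j t (x y : E), |g j t * auxCl (x.2 j) - g j t * auxCl (y.2 j)| ≤ C * ‖x - y‖ := by
    intro j t x y
    rw [← mul_sub, abs_mul, abs_of_nonneg (hg0 j t)]
    exact mul_le_mul (hgC j t) ((auxCl_lip _ _).trans (hc2 x y j)) (abs_nonneg _) hC
  have hnC : 0 ≤ (n : ℝ) * C := by positivity
  have hLip : ∀ t x y, ‖F t x - F t y‖ ≤ (n * (2 * C) + C + 1) * ‖x - y‖ := by
    intro t x y
    have hN := norm_nonneg (x - y)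
    rw [Prod.norm_def]
    refine max_le ?_ ?_ <;> rw [pi_norm_le_iff_of_nonneg (by positivity)] <;> intro j <;>
      rw [Real.norm_eq_abs]
    · have : (F t x - F t y).1 j = -(a j t x - a j t y) := by
        change -(a j t x) - -(a j t y) = _
        ring
      rw [this, abs_neg]
      have := haL j t x y
      nlinarith
    · have : (F t x - F t y).2 j = (a j t x - a j t y)
        - (g j t * auxCl (x.2 j) - g j t * auxCl (y.2 j)) := by
        change (a j t x - g j t * auxCl (x.2 j)) - (a j t y - g j t * auxCl (y.2 j)) = _
        ring
      rw [this]
      refine (abs_sub _ _).trans ?_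
      have := haL j t x y
      have := hgL j t x y
      nlinarith
  have hgc : ∀ j t (x : E), g j t * auxCl (x.2 j) ≤ C := fun j t x => by
    have := mul_le_mul (hgC j t) (auxCl_le_one (x.2 j)) (auxCl_nonneg _) hC
    linarith
  have hgc0 : ∀ j t (x : E), 0 ≤ g j t * auxCl (x.2 j) := fun j t x =>
    mul_nonneg (hg0 j t) (auxCl_nonneg _)
  have hM : ∀ t x, ‖F t x‖ ≤ n * C + C := by
    intro t x
    rw [Prod.norm_def]
    refine max_le ?_ ?_ <;> rw [pi_norm_le_iff_of_nonneg (by positivity)] <;> intro j <;>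
      rw [Real.norm_eq_abs, abs_le] <;> simp only [F]
    · have := ha0 j t x
      have := haC j t x
      constructor <;> linarith
    · have := ha0 j t x
      have := haC j t x
      have := hgc j t x
      have := hgc0 j t x
      constructor <;> linarith
  have ham : ∀ (u : ℝ → E), Continuous u → ∀ j, Measurable fun t => a j t (u t) := by
    intro u hu j
    have h1 : ∀ k, Measurable fun t => auxCl ((u t).1 k) := fun k =>
      (auxCl_cont.comp ((continuous_apply k).comp (continuous_fst.comp hu))).measurable
    have h2 : ∀ k, Measurable fun t => auxCl ((u t).2 k) := fun k =>
      (auxCl_cont.comp ((continuous_apply k).comp (continuous_snd.comp hu))).measurable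
    exact (h1 j).mul (Finset.measurable_sum _ fun k _ => (hBm j k).mul (h2 k))
  have hgm' : ∀ (u : ℝ → E), Continuous u → ∀ j, Measurable fun t => g j t * auxCl ((u t).2 j) := by
    intro u hu j
    exact (hgm j).mul
      (auxCl_cont.comp ((continuous_apply j).comp (continuous_snd.comp hu))).measurable
  have hFm : ∀ u : ℝ → E, Continuous u → Measurable (fun t => F t (u t)) := by
    intro u hu
    exact (measurable_pi_lambda _ fun j => (ham u hu j).neg).prodMk
      (measurable_pi_lambda _ fun j => (ham u hu j).sub (hgm' u hu j))
  obtain ⟨u, hu, hueq⟩ := aux_exists_car F (n * (2 * C) + C + 1) (n * C + C) (by positivity)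
    hLip hM (fun u hu => (hFm u hu).aestronglyMeasurable) (s0, i0)
  have hbdd : ∀ (f : ℝ → ℝ) (R : ℝ), Measurable f → (∀ t, |f t| ≤ R) → ∀ a b : ℝ,
      IntervalIntegrable f volume a b := by
    intro f R hf hR a b
    refine (intervalIntegrable_const (c := R)).mono_fun hf.aestronglyMeasurable ?_
    exact Eventually.of_forall fun t => (hR t).trans (le_abs_self R)
  have hai : ∀ j (p q : ℝ), IntervalIntegrable (fun t => a j t (u t)) volume p q := fun j =>
    hbdd _ (n * C) (ham u hu j) fun t => by rw [abs_of_nonneg (ha0 _ _ _)]; exact haC _ _ _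
  have hgi : ∀ j (p q : ℝ), IntervalIntegrable (fun t => g j t * auxCl ((u t).2 j)) volume p q :=
    fun j => hbdd _ C (hgm' u hu j) fun t => by
      rw [abs_of_nonneg (hgc0 _ _ _)]; exact hgc _ _ _
  have hFi : ∀ p q : ℝ, IntervalIntegrable (fun t => F t (u t)) volume p q := by
    intro p q
    refine (intervalIntegrable_const (c := n * C + C)).mono_fun
      (hFm u hu).aestronglyMeasurable ?_
    exact Eventually.of_forall fun t => (hM t _).trans (le_abs_self _)
  have hs : ∀ j t, 0 ≤ t → (u t).1 j = s0 j + ∫ τ in (0:ℝ)..t, -(a j τ (u τ)) := by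
    intro j t ht
    have h := congrArg ((ContinuousLinearMap.proj (R := ℝ) (φ := fun _ : Fin n => ℝ) j).comp
      (ContinuousLinearMap.fst ℝ (Fin n → ℝ) (Fin n → ℝ))) (hueq t ht)
    rw [map_add, ← ContinuousLinearMap.intervalIntegral_comp_comm _ (hFi 0 t)] at h
    exact h
  have hi : ∀ j t, 0 ≤ t →
      (u t).2 j = i0 j + ∫ τ in (0:ℝ)..t, (a j τ (u τ) - g j τ * auxCl ((u τ).2 j)) := by
    intro j t ht
    have h := congrArg ((ContinuousLinearMap.proj (R := ℝ) (φ := fun _ : Fin n => ℝ) j).comp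
      (ContinuousLinearMap.snd ℝ (Fin n → ℝ) (Fin n → ℝ))) (hueq t ht)
    rw [map_add, ← ContinuousLinearMap.intervalIntegral_comp_comm _ (hFi 0 t)] at h
    exact h
  have hcs : ∀ j, Continuous fun t => (u t).1 j := fun j =>
    (continuous_apply j).comp (continuous_fst.comp hu)
  have hci : ∀ j, Continuous fun t => (u t).2 j := fun j =>
    (continuous_apply j).comp (continuous_snd.comp hu)
  have hs00 : ∀ j, (u 0).1 j = s0 j := fun j => by rw [hs j 0 le_rfl]; simp
  have hi00 : ∀ j, (u 0).2 j = i0 j := fun j => by rw [hi j 0 le_rfl]; simp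
  have hspos : ∀ j t, 0 ≤ t → 0 ≤ (u t).1 j := fun j =>
    aux_nonneg (fun t => (u t).1 j) (fun τ => -(a j τ (u τ))) (hcs j) (fun p q => (hai j p q).neg)
      (fun t ht => by simp only [hs00]; exact hs j t ht) (by simp only [hs00]; exact hs0 j)
      (fun τ hτ => by simp [a, auxCl_of_neg hτ])
  have hipos : ∀ j t, 0 ≤ t → 0 ≤ (u t).2 j := fun j =>
    aux_nonneg (fun t => (u t).2 j) (fun τ => a j τ (u τ) - g j τ * auxCl ((u τ).2 j)) (hci j)
      (fun p q => (hai j p q).sub (hgi j p q))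
      (fun t ht => by simp only [hi00]; exact hi j t ht) (by simp only [hi00]; exact hi0 j)
      (fun τ hτ => by rw [auxCl_of_neg hτ, mul_zero, sub_zero]; exact ha0 _ _ _)
  have hle : ∀ j t, 0 ≤ t → (u t).1 j + (u t).2 j ≤ 1 := by
    intro j t ht
    have h0 : 0 ≤ ∫ τ in (0:ℝ)..t, g j τ * auxCl ((u τ).2 j) :=
      intervalIntegral.integral_nonneg ht fun τ _ => hgc0 _ _ _
    rw [hs j t ht, hi j t ht, intervalIntegral.integral_neg,
      intervalIntegral.integral_sub (hai j 0 t) (hgi j 0 t)]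
    have := hsum j
    have := hr0 j
    linarith
  have hcls : ∀ j t, 0 ≤ t → auxCl ((u t).1 j) = (u t).1 j := fun j t ht =>
    auxCl_of_mem (hspos j t ht) (by linarith [hle j t ht, hipos j t ht])
  have hcli : ∀ j t, 0 ≤ t → auxCl ((u t).2 j) = (u t).2 j := fun j t ht =>
    auxCl_of_mem (hipos j t ht) (by linarith [hle j t ht, hspos j t ht])
  have haeq : ∀ j t, 0 ≤ t → a j t (u t) = (u t).1 j * ∑ k, B j k t * (u t).2 k := by
    intro j t ht
    simp only [a, hcls j t ht, hcli _ t ht]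
  refine ⟨fun j t => (u t).1 j, fun j t => (u t).2 j,
    fun j t => r0 j + ∫ τ in (0:ℝ)..t, g j τ * auxCl ((u τ).2 j),
    fun j => ⟨hcs j, hci j, continuous_const.add
      (intervalIntegral.continuous_primitive (hgi j) 0)⟩,
    fun j => ⟨hs00 j, hi00 j, by simp⟩, fun j t ht => ⟨?_, ?_, ?_⟩⟩
  · try simp only
    rw [hs j t ht, intervalIntegral.integral_neg, ← sub_eq_add_neg]
    congr 1
    refine intervalIntegral.integral_congr fun τ hτ => ?_
    rw [uIcc_of_le ht] at hτ
    exact haeq j τ hτ.1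
  · try simp only
    rw [hi j t ht]
    congr 1
    refine intervalIntegral.integral_congr fun τ hτ => ?_
    rw [uIcc_of_le ht] at hτ
    try simp only
    rw [haeq j τ hτ.1, hcli j τ hτ.1]
  · try simp only
    congr 1
    refine intervalIntegral.integral_congr fun τ hτ => ?_
    rw [uIcc_of_le ht] at hτ
    try simp only
    rw [hcli j τ hτ.1]

lemma aux_core_unique (n : ℕ) (B : Fin n → Fin n → ℝ → ℝ) (g : Fin n → ℝ → ℝ) (C : ℝ)
    (hBm : ∀ j k, Measurable (B j k)) (hgm : ∀ j, Measurable (g j))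
    (hB0 : ∀ j k t, 0 ≤ B j k t) (hBC : ∀ j k t, B j k t ≤ C)
    (hg0 : ∀ j t, 0 ≤ g j t) (hgC : ∀ j t, g j t ≤ C) (hC : 0 ≤ C)
    (s0 i0 : Fin n → ℝ) (s₁ i₁ s₂ i₂ : Fin n → ℝ → ℝ)
    (hs₁c : ∀ j, Continuous (s₁ j)) (hi₁c : ∀ j, Continuous (i₁ j))
    (hs₂c : ∀ j, Continuous (s₂ j)) (hi₂c : ∀ j, Continuous (i₂ j))
    (hs₁ : ∀ j t, 0 ≤ t → s₁ j t = s0 j - ∫ τ in (0:ℝ)..t, s₁ j τ * ∑ k, B j k τ * i₁ k τ)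
    (hi₁ : ∀ j t, 0 ≤ t →
      i₁ j t = i0 j + ∫ τ in (0:ℝ)..t, (s₁ j τ * (∑ k, B j k τ * i₁ k τ) - g j τ * i₁ j τ))
    (hs₂ : ∀ j t, 0 ≤ t → s₂ j t = s0 j - ∫ τ in (0:ℝ)..t, s₂ j τ * ∑ k, B j k τ * i₂ k τ)
    (hi₂ : ∀ j t, 0 ≤ t →
      i₂ j t = i0 j + ∫ τ in (0:ℝ)..t, (s₂ j τ * (∑ k, B j k τ * i₂ k τ) - g j τ * i₂ j τ)) :
    ∀ j t, 0 ≤ t → s₁ j t = s₂ j t ∧ i₁ j t = i₂ j t := by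
  intro j₀ T hT
  let D : ℝ → ℝ := fun τ => ∑ j, (|s₁ j τ - s₂ j τ| + |i₁ j τ - i₂ j τ|)
  have hDc : Continuous D := by fun_prop
  have hD0 : ∀ t, 0 ≤ D t := fun t => Finset.sum_nonneg fun j _ => by positivity
  have hDj : ∀ j τ, |s₁ j τ - s₂ j τ| + |i₁ j τ - i₂ j τ| ≤ D τ := fun j τ =>
    Finset.single_le_sum (f := fun j => |s₁ j τ - s₂ j τ| + |i₁ j τ - i₂ j τ|)
      (fun j _ => by positivity) (Finset.mem_univ j)
  have hDs : ∀ j τ, |s₁ j τ - s₂ j τ| ≤ D τ := fun j τ => by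
    linarith [hDj j τ, abs_nonneg (i₁ j τ - i₂ j τ)]
  have hDi : ∀ j τ, |i₁ j τ - i₂ j τ| ≤ D τ := fun j τ => by
    linarith [hDj j τ, abs_nonneg (s₁ j τ - s₂ j τ)]
  obtain ⟨R, hR⟩ := (isCompact_Icc (a := (0:ℝ)) (b := T)).exists_bound_of_continuousOn
    (f := fun τ => ∑ j, (|s₂ j τ| + |i₁ j τ|)) (by fun_prop)
  have hRj : ∀ j, ∀ τ ∈ Icc 0 T, |s₂ j τ| + |i₁ j τ| ≤ R := fun j τ hτ =>
    (Finset.single_le_sum (f := fun j => |s₂ j τ| + |i₁ j τ|)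
      (fun j _ => by positivity) (Finset.mem_univ j)).trans ((le_abs_self _).trans (hR τ hτ))
  have hRs : ∀ j, ∀ τ ∈ Icc 0 T, |s₂ j τ| ≤ R := fun j τ hτ => by
    linarith [hRj j τ hτ, abs_nonneg (i₁ j τ)]
  have hRi : ∀ j, ∀ τ ∈ Icc 0 T, |i₁ j τ| ≤ R := fun j τ hτ => by
    linarith [hRj j τ hτ, abs_nonneg (s₂ j τ)]
  have hR0 : 0 ≤ R := (abs_nonneg _).trans (hRs j₀ 0 ⟨le_rfl, hT⟩)
  have hbdd : ∀ (f : ℝ → ℝ), Measurable f → (∀ t, 0 ≤ f t) → (∀ t, f t ≤ C) → ∀ a b : ℝ,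
      IntervalIntegrable f volume a b := by
    intro f hf h0 hR a b
    refine (intervalIntegrable_const (c := C)).mono_fun hf.aestronglyMeasurable ?_
    exact Eventually.of_forall fun t => by
      change |f t| ≤ |C|
      rw [abs_of_nonneg (h0 t)]; exact (hR t).trans (le_abs_self C)
  have hint : ∀ (s i : Fin n → ℝ → ℝ), (∀ j, Continuous (s j)) → (∀ j, Continuous (i j)) →
      ∀ j (a b : ℝ), IntervalIntegrable (fun τ => s j τ * ∑ k, B j k τ * i k τ) volume a b := by
    intro s i hs hi j a b
    refine IntervalIntegrable.continuousOn_mul ?_ (hs j).continuousOn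
    have h : (fun τ => ∑ k, B j k τ * i k τ) = ∑ k, fun τ => B j k τ * i k τ := by
      ext τ
      simp
    rw [h]
    exact IntervalIntegrable.sum Finset.univ
      (fun k _ => (hbdd _ (hBm j k) (hB0 j k) (hBC j k) a b).mul_continuousOn (hi k).continuousOn)
  have hintg : ∀ (i : Fin n → ℝ → ℝ), (∀ j, Continuous (i j)) →
      ∀ j (a b : ℝ), IntervalIntegrable (fun τ => g j τ * i j τ) volume a b := by
    intro i hi j a b
    exact (hbdd _ (hgm j) (hg0 j) (hgC j) a b).mul_continuousOn (hi j).continuousOn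
  let Q : ℝ := n * (2 * (C * R))
  have hpt : ∀ j, ∀ τ ∈ Icc 0 T,
      |s₁ j τ * (∑ k, B j k τ * i₁ k τ) - s₂ j τ * (∑ k, B j k τ * i₂ k τ)| ≤ Q * D τ := by
    intro j τ hτ
    rw [Finset.mul_sum, Finset.mul_sum, ← Finset.sum_sub_distrib]
    refine (Finset.abs_sum_le_sum_abs _ _).trans ?_
    have : ∑ k, |s₁ j τ * (B j k τ * i₁ k τ) - s₂ j τ * (B j k τ * i₂ k τ)|
        ≤ ∑ k : Fin n, 2 * (C * R) * D τ := by
      refine Finset.sum_le_sum fun k _ => ?_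
      refine (aux_bilin _ C _ _ _ _ R (hB0 j k τ) (hBC j k τ) (hRs j τ hτ) (hRi k τ hτ)).trans ?_
      have h1 := hDs j τ
      have h2 := hDi k τ
      have : 0 ≤ C * R := by positivity
      nlinarith
    refine this.trans (le_of_eq ?_)
    simp [Q]; ring
  have hgpt : ∀ j τ, |g j τ * i₁ j τ - g j τ * i₂ j τ| ≤ C * D τ := by
    intro j τ
    rw [← mul_sub, abs_mul, abs_of_nonneg (hg0 j τ)]
    exact mul_le_mul (hgC j τ) (hDi j τ) (abs_nonneg _) hC
  have hDint : ∀ a b : ℝ, IntervalIntegrable D volume a b := hDc.intervalIntegrable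
  have hsd : ∀ j, ∀ t ∈ Icc 0 T, |s₁ j t - s₂ j t| ≤ Q * ∫ τ in (0:ℝ)..t, D τ := by
    intro j t ht
    rw [hs₁ j t ht.1, hs₂ j t ht.1, sub_sub_sub_cancel_left, abs_sub_comm,
      ← intervalIntegral.integral_sub (hint _ _ hs₁c hi₁c j _ _) (hint _ _ hs₂c hi₂c j _ _),
      ← intervalIntegral.integral_const_mul]
    rw [← Real.norm_eq_abs]
    refine intervalIntegral.norm_integral_le_of_norm_le ht.1 ?_ ((hDint _ _).const_mul Q)
    exact Eventually.of_forall fun τ hτ => hpt j τ ⟨hτ.1.le, hτ.2.trans ht.2⟩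
  have hid : ∀ j, ∀ t ∈ Icc 0 T, |i₁ j t - i₂ j t| ≤ (Q + C) * ∫ τ in (0:ℝ)..t, D τ := by
    intro j t ht
    rw [hi₁ j t ht.1, hi₂ j t ht.1, add_sub_add_left_eq_sub,
      ← intervalIntegral.integral_sub
        ((hint _ _ hs₁c hi₁c j _ _).sub (hintg _ hi₁c j _ _))
        ((hint _ _ hs₂c hi₂c j _ _).sub (hintg _ hi₂c j _ _)),
      ← intervalIntegral.integral_const_mul]
    rw [← Real.norm_eq_abs]
    refine intervalIntegral.norm_integral_le_of_norm_le ht.1 ?_ ((hDint _ _).const_mul (Q + C))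
    refine Eventually.of_forall fun τ hτ => ?_
    have h1 := hpt j τ ⟨hτ.1.le, hτ.2.trans ht.2⟩
    have h2 := hgpt j τ
    rw [Real.norm_eq_abs, sub_sub_sub_comm, add_mul]
    exact (abs_sub _ _).trans (add_le_add h1 h2)
  have hDz := aux_gronwall D hDc hD0 (n * (2 * Q + C)) T (by
    intro t ht
    have : D t ≤ ∑ j : Fin n, (2 * Q + C) * ∫ τ in (0:ℝ)..t, D τ := by
      refine Finset.sum_le_sum fun j _ => ?_
      have := hsd j t ht
      have := hid j t ht
      linarith
    refine this.trans (le_of_eq ?_)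
    simp; ring) T ⟨hT, le_rfl⟩
  have h1 := hDs j₀ T
  have h2 := hDi j₀ T
  rw [hDz] at h1 h2
  exact ⟨sub_eq_zero.mp (abs_nonpos_iff.mp h1), sub_eq_zero.mp (abs_nonpos_iff.mp h2)⟩

/-- global existence and uniqueness for the graph SIR system. -/
theorem graphSIR_existence_uniqueness
    (n : ℕ) (hn : 1 ≤ n)
    (β γ : Fin n → ℝ → ℝ) (A : Fin n → Fin n → ℝ → ℝ)
    (hβm : ∀ j, Measurable (β j)) (hγm : ∀ j, Measurable (γ j))
    (hAm : ∀ j k, Measurable (A j k))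
    (hβb : ∀ j, ∃ C : ℝ, ∀ᵐ t ∂(volume.restrict (Set.Ici (0:ℝ))), |β j t| ≤ C)
    (hγb : ∀ j, ∃ C : ℝ, ∀ᵐ t ∂(volume.restrict (Set.Ici (0:ℝ))), |γ j t| ≤ C)
    (hAb : ∀ j k, ∃ C : ℝ, ∀ᵐ t ∂(volume.restrict (Set.Ici (0:ℝ))), |A j k t| ≤ C)
    (hβ0 : ∀ j, ∀ᵐ t ∂(volume.restrict (Set.Ici (0:ℝ))), 0 ≤ β j t)
    (hγ0 : ∀ j, ∀ᵐ t ∂(volume.restrict (Set.Ici (0:ℝ))), 0 ≤ γ j t)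
    (hA0 : ∀ j k, ∀ᵐ t ∂(volume.restrict (Set.Ici (0:ℝ))), 0 ≤ A j k t)
    (s0 i0 r0 : Fin n → ℝ)
    (hinit : ∀ j, 0 ≤ s0 j ∧ s0 j ≤ 1 ∧ 0 ≤ i0 j ∧ i0 j ≤ 1 ∧ 0 ≤ r0 j ∧ r0 j ≤ 1 ∧
      s0 j + i0 j + r0 j = 1) :
    (∃ s i r : Fin n → ℝ → ℝ,
      IsGraphSIRSol n (Set.Ici 0) β γ A s i r ∧
      (∀ j, s j 0 = s0 j ∧ i j 0 = i0 j ∧ r j 0 = r0 j)) ∧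
    (∀ s₁ i₁ r₁ s₂ i₂ r₂ : Fin n → ℝ → ℝ,
      IsGraphSIRSol n (Set.Ici 0) β γ A s₁ i₁ r₁ →
      (∀ j, s₁ j 0 = s0 j ∧ i₁ j 0 = i0 j ∧ r₁ j 0 = r0 j) →
      IsGraphSIRSol n (Set.Ici 0) β γ A s₂ i₂ r₂ →
      (∀ j, s₂ j 0 = s0 j ∧ i₂ j 0 = i0 j ∧ r₂ j 0 = r0 j) →
      ∀ j : Fin n, ∀ t ∈ Set.Ici (0:ℝ),
        s₁ j t = s₂ j t ∧ i₁ j t = i₂ j t ∧ r₁ j t = r₂ j t) := by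
  classical
  choose cβ hcβ using hβb
  choose cγ hcγ using hγb
  choose cA hcA using hAb
  obtain ⟨C₁, hC₁⟩ := (Set.finite_range
    (fun p : Fin n × Fin n => 1 / (n : ℝ) * (cβ p.2 * cA p.1 p.2))).bddAbove
  obtain ⟨C₂, hC₂⟩ := (Set.finite_range cγ).bddAbove
  let C : ℝ := max 0 (max C₁ C₂)
  have hC : 0 ≤ C := le_max_left _ _
  let B : Fin n → Fin n → ℝ → ℝ := fun j k t =>
    max 0 (min C (1 / (n : ℝ) * (β k t * A j k t)))
  let g : Fin n → ℝ → ℝ := fun j t => max 0 (min C (γ j t))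
  have hBm : ∀ j k, Measurable (B j k) := fun j k =>
    measurable_const.max (measurable_const.min (((hβm k).mul (hAm j k)).const_mul _))
  have hgm : ∀ j, Measurable (g j) := fun j =>
    measurable_const.max (measurable_const.min (hγm j))
  have hB0 : ∀ j k t, 0 ≤ B j k t := fun j k t => le_max_left _ _
  have hBC : ∀ j k t, B j k t ≤ C := fun j k t => max_le hC (min_le_left _ _)
  have hg0 : ∀ j t, 0 ≤ g j t := fun j t => le_max_left _ _
  have hgC : ∀ j t, g j t ≤ C := fun j t => max_le hC (min_le_left _ _)
  have hae : ∀ᵐ t ∂(volume.restrict (Set.Ici (0:ℝ))),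
      (∀ j k, B j k t = 1 / (n : ℝ) * (β k t * A j k t)) ∧ (∀ j, g j t = γ j t) := by
    filter_upwards [ae_all_iff.2 hcβ, ae_all_iff.2 hcγ,
      ae_all_iff.2 fun j => ae_all_iff.2 (hcA j), ae_all_iff.2 hβ0, ae_all_iff.2 hγ0,
      ae_all_iff.2 fun j => ae_all_iff.2 (hA0 j)] with t h1 h2 h3 h4 h5 h6
    refine ⟨fun j k => ?_, fun j => ?_⟩
    · have hb := (le_abs_self _).trans (h1 k)
      have ha := (le_abs_self _).trans (h3 j k)
      have hn0 : 0 ≤ 1 / (n : ℝ) := by positivity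
      have hp : 0 ≤ 1 / (n : ℝ) * (β k t * A j k t) :=
        mul_nonneg hn0 (mul_nonneg (h4 k) (h6 j k))
      have hq : 1 / (n : ℝ) * (β k t * A j k t) ≤ C := by
        refine (mul_le_mul_of_nonneg_left (mul_le_mul hb ha (h6 j k) ((h4 k).trans hb)) hn0).trans ?_
        exact (hC₁ ⟨(j, k), rfl⟩).trans ((le_max_left _ _).trans (le_max_right _ _))
      simp only [B, min_eq_right hq, max_eq_right hp]
    · have hb := (le_abs_self _).trans (h2 j)
      have hq : γ j t ≤ C :=
        hb.trans ((hC₂ ⟨j, rfl⟩).trans ((le_max_right _ _).trans (le_max_right _ _)))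
      simp only [g, min_eq_right hq, max_eq_right (h5 j)]
  have hae' : ∀ t : ℝ, 0 ≤ t → ∀ᵐ τ ∂volume, τ ∈ Set.uIoc 0 t →
      (0 ≤ τ ∧ (∀ j k, B j k τ = 1 / (n : ℝ) * (β k τ * A j k τ)) ∧ (∀ j, g j τ = γ j τ)) := by
    intro t ht
    filter_upwards [(ae_restrict_iff' measurableSet_Ici).1 hae] with τ h hτ
    rw [uIoc_of_le ht] at hτ
    exact ⟨hτ.1.le, h hτ.1.le⟩
  -- conversion of the integrals between the original and the truncated coefficients
  have hconv : ∀ (s i s' i' : Fin n → ℝ → ℝ),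
      (∀ j τ, 0 ≤ τ → s' j τ = s j τ) → (∀ j τ, 0 ≤ τ → i' j τ = i j τ) →
      ∀ j t, 0 ≤ t →
      (∫ τ in (0:ℝ)..t, s j τ * (1 / (n : ℝ) * ∑ k : Fin n, β k τ * A j k τ * i k τ))
        = (∫ τ in (0:ℝ)..t, s' j τ * ∑ k, B j k τ * i' k τ) ∧
      (∫ τ in (0:ℝ)..t,
        (s j τ * (1 / (n : ℝ) * ∑ k : Fin n, β k τ * A j k τ * i k τ) - γ j τ * i j τ))
        = (∫ τ in (0:ℝ)..t, (s' j τ * (∑ k, B j k τ * i' k τ) - g j τ * i' j τ)) ∧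
      (∫ τ in (0:ℝ)..t, γ j τ * i j τ) = ∫ τ in (0:ℝ)..t, g j τ * i' j τ := by
    intro s i s' i' hs hi j t ht
    have hsum : ∀ τ, 0 ≤ τ → (∀ j k, B j k τ = 1 / (n : ℝ) * (β k τ * A j k τ)) →
        1 / (n : ℝ) * ∑ k : Fin n, β k τ * A j k τ * i k τ = ∑ k, B j k τ * i' k τ := by
      intro τ h0 h
      rw [Finset.mul_sum]
      refine Finset.sum_congr rfl fun k _ => ?_
      rw [h, hi k τ h0]
      ring
    refine ⟨?_, ?_, ?_⟩ <;> refine intervalIntegral.integral_congr_ae ?_ <;>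
      filter_upwards [hae' t ht] with τ h hτ <;> obtain ⟨h0, h1, h2⟩ := h hτ
    · rw [hsum τ h0 h1, hs j τ h0]
    · rw [hsum τ h0 h1, hs j τ h0, hi j τ h0, h2]
    · rw [hi j τ h0, h2]
  constructor
  · obtain ⟨s, i, r, hc, h0, heq⟩ := aux_core_exists n B g C hBm hgm hB0 hBC hg0 hgC hC s0 i0 r0
      (fun j => (hinit j).1) (fun j => (hinit j).2.2.1) (fun j => (hinit j).2.2.2.2.1)
      (fun j => (hinit j).2.2.2.2.2.2)
    refine ⟨s, i, r, ⟨fun j => ⟨(hc j).1.continuousOn, (hc j).2.1.continuousOn,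
      (hc j).2.2.continuousOn⟩, fun j t ht => ?_⟩, h0⟩
    obtain ⟨e1, e2, e3⟩ := hconv s i s i (fun _ _ _ => rfl) (fun _ _ _ => rfl) j t ht
    rw [e1, e2, e3, (h0 j).1, (h0 j).2.1, (h0 j).2.2]
    exact heq j t ht
  · intro s₁ i₁ r₁ s₂ i₂ r₂ hsol₁ hin₁ hsol₂ hin₂
    let ext : (Fin n → ℝ → ℝ) → Fin n → ℝ → ℝ := fun f j t => f j (max t 0)
    have hext : ∀ f j τ, 0 ≤ τ → ext f j τ = f j τ := fun f j τ hτ => by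
      simp only [ext, max_eq_left hτ]
    have hextc : ∀ f : Fin n → ℝ → ℝ, (∀ j, ContinuousOn (f j) (Set.Ici 0)) →
        ∀ j, Continuous (ext f j) := fun f hf j =>
      (hf j).comp_continuous (continuous_id.max continuous_const) fun t => Set.mem_Ici.2 (le_max_right _ _)
    have key : ∀ s i r : Fin n → ℝ → ℝ, IsGraphSIRSol n (Set.Ici 0) β γ A s i r →
        (∀ j, s j 0 = s0 j ∧ i j 0 = i0 j ∧ r j 0 = r0 j) →
        (∀ j, Continuous (ext s j)) ∧ (∀ j, Continuous (ext i j)) ∧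
        (∀ j t, 0 ≤ t → ext s j t
          = s0 j - ∫ τ in (0:ℝ)..t, ext s j τ * ∑ k, B j k τ * ext i k τ) ∧
        (∀ j t, 0 ≤ t → ext i j t = i0 j + ∫ τ in (0:ℝ)..t,
          (ext s j τ * (∑ k, B j k τ * ext i k τ) - g j τ * ext i j τ)) := by
      intro s i r hsol hin
      refine ⟨hextc s fun j => (hsol.1 j).1, hextc i fun j => (hsol.1 j).2.1,
        fun j t ht => ?_, fun j t ht => ?_⟩
      · rw [hext _ _ _ ht, ← (hconv s i (ext s) (ext i) (hext s) (hext i) j t ht).1, ← (hin j).1]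
        exact (hsol.2 j t ht).1
      · rw [hext _ _ _ ht, ← (hconv s i (ext s) (ext i) (hext s) (hext i) j t ht).2.1,
          ← (hin j).2.1]
        exact (hsol.2 j t ht).2.1
    obtain ⟨a1, a2, a3, a4⟩ := key s₁ i₁ r₁ hsol₁ hin₁
    obtain ⟨b1, b2, b3, b4⟩ := key s₂ i₂ r₂ hsol₂ hin₂
    have hu := aux_core_unique n B g C hBm hgm hB0 hBC hg0 hgC hC s0 i0 (ext s₁) (ext i₁)
      (ext s₂) (ext i₂) a1 a2 b1 b2 a3 a4 b3 b4
    have hii : ∀ j t, 0 ≤ t → i₁ j t = i₂ j t := fun j t ht => by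
      rw [← hext i₁ j t ht, ← hext i₂ j t ht]
      exact (hu j t ht).2
    intro j t ht
    refine ⟨?_, hii j t ht, ?_⟩
    · rw [← hext s₁ j t ht, ← hext s₂ j t ht]
      exact (hu j t ht).1
    · rw [(hsol₁.2 j t ht).2.2, (hsol₂.2 j t ht).2.2, (hin₁ j).2.2, (hin₂ j).2.2]
      congr 1
      refine intervalIntegral.integral_congr fun τ hτ => ?_
      rw [uIcc_of_le ht] at hτ
      change γ j τ * i₁ j τ = γ j τ * i₂ j τ
      rw [hii j τ hτ.1]

end
end

section
/- Fix an integer n ≥ 1 and suppose that for every j, k ∈ {1,…,n} the coefficients β^n_j, γ^n_j, A^n_{jk} : [0,∞) → ℝ are measurable, essentially bounded, and nonnegative almost everywhere, and let the initial datum satisfy 0 ≤ s^n_{j,0}, i^n_{j,0}, r^n_{j,0} ≤ 1 and s^n_{j,0} + i^n_{j,0} + r^n_{j,0} = 1 for every j. Then any global solution (s^n_j, i^n_j, r^n_j)_{j=1,…,n} of the graph SIR system attaining this datum satisfies, for every t ≥ 0 and every j = 1,…,n: 0 ≤ s^n_j(t), i^n_j(t), r^n_j(t) ≤ 1 and s^n_j(t)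 + i^n_j(t) + r^n_j(t) = 1. -/
open MeasureTheory Real Filter Set

noncomputable section

/-- Integral Gronwall inequality with zero initial value. -/
theorem gron_zero (N : ℝ → ℝ) (hN : Continuous N) (hN0 : ∀ t, 0 ≤ N t) (T K : ℝ)
    (h : ∀ t ∈ Set.Icc 0 T, N t ≤ K * ∫ τ in (0:ℝ)..t, N τ) :
    ∀ t ∈ Set.Icc 0 T, N t ≤ 0 := by
  have hd : ∀ x, HasDerivAt (fun t => ∫ τ in (0:ℝ)..t, N τ) (N x) x := fun x =>
    intervalIntegral.integral_hasDerivAt_right (hN.intervalIntegrable _ _)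
      (hN.stronglyMeasurableAtFilter _ _) hN.continuousAt
  have key := norm_le_gronwallBound_of_norm_deriv_right_le
    (f := fun t => ∫ τ in (0:ℝ)..t, N τ) (f' := N) (δ := 0) (K := K) (ε := 0) (a := 0) (b := T)
    (fun x _ => (hd x).continuousAt.continuousWithinAt)
    (fun x _ => (hd x).hasDerivWithinAt) (by simp)
    (fun x hx => by
      have hx' : x ∈ Set.Icc 0 T := ⟨hx.1, hx.2.le⟩
      have hp : 0 ≤ ∫ τ in (0:ℝ)..x, N τ :=
        intervalIntegral.integral_nonneg hx.1 (fun u _ => hN0 u)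
      rw [Real.norm_of_nonneg (hN0 x), Real.norm_of_nonneg hp]
      simpa using h x hx')
  intro t ht
  have h1 := key t ht
  rw [gronwallBound_ε0_δ0] at h1
  have h2 : ∫ τ in (0:ℝ)..t, N τ = 0 := norm_le_zero_iff.1 h1
  have := h t ht
  rwa [h2, mul_zero] at this

/-- Quasi-positivity principle for integral equations. -/
theorem quasi_pos {ι : Type*} [Fintype ι] (f g : ι → ℝ → ℝ) (T C : ℝ) (hC : 0 ≤ C)
    (hc : ∀ j, ContinuousOn (f j) (Set.Ici 0))
    (hg : ∀ j, IntervalIntegrable (g j) volume 0 T)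
    (hint : ∀ j, ∀ t ∈ Set.Icc 0 T, f j t = f j 0 + ∫ τ in (0:ℝ)..t, g j τ)
    (h0 : ∀ j, 0 ≤ f j 0)
    (hlow : ∀ j, ∀ᵐ τ ∂(volume.restrict (Set.Ici (0:ℝ))), τ ≤ T → f j τ < 0 →
      -(C * ∑ k, max (-f k τ) 0) ≤ g j τ) :
    ∀ j, ∀ t ∈ Set.Icc 0 T, 0 ≤ f j t := by
  set N : ℝ → ℝ := fun t => ∑ k, max (-f k (max t 0)) 0 with hNdef
  have hNc : Continuous N := by
    refine continuous_finsetSum _ fun k _ => ?_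
    have : Continuous (fun t : ℝ => f k (max t 0)) :=
      (hc k).comp_continuous (by fun_prop) (fun t => le_max_right t 0)
    exact this.neg.max continuous_const
  have hN0 : ∀ t, 0 ≤ N t := fun t => Finset.sum_nonneg fun k _ => le_max_right _ _
  have hNe : ∀ t, 0 ≤ t → N t = ∑ k, max (-f k t) 0 := fun t ht => by
    simp only [hNdef, max_eq_left ht]
  have step : ∀ j, ∀ t ∈ Set.Icc 0 T, max (-f j t) 0 ≤ C * ∫ τ in (0:ℝ)..t, N τ := by
    intro j t ht
    have hpos : ∀ u, 0 ≤ u → 0 ≤ ∫ τ in (0:ℝ)..u, N τ := fun u hu =>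
      intervalIntegral.integral_nonneg hu (fun u _ => hN0 u)
    refine max_le ?_ (mul_nonneg hC (hpos t ht.1))
    by_cases hft : 0 ≤ f j t
    · linarith [mul_nonneg hC (hpos t ht.1)]
    push Not at hft
    have hcl : IsCompact (Set.Icc 0 t ∩ f j ⁻¹' Set.Ici 0) :=
      isCompact_Icc.of_isClosed_subset
        (((hc j).mono Set.Icc_subset_Ici_self).preimage_isClosed_of_isClosed
          isClosed_Icc isClosed_Ici) Set.inter_subset_left
    obtain ⟨u, ⟨hu, hfu⟩, hmax⟩ := hcl.exists_isGreatest ⟨0, ⟨⟨le_rfl, ht.1⟩, h0 j⟩⟩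
    have hfu' : 0 ≤ f j u := hfu
    have hneg : ∀ τ ∈ Set.Ioc u t, f j τ < 0 := by
      intro τ hτ
      by_contra hcon
      push Not at hcon
      have := hmax ⟨⟨hu.1.trans hτ.1.le, hτ.2⟩, hcon⟩
      linarith [hτ.1]
    have huT : u ∈ Set.Icc 0 T := ⟨hu.1, hu.2.trans ht.2⟩
    have hT0 : (0:ℝ) ≤ T := ht.1.trans ht.2
    have i1 : IntervalIntegrable (g j) volume 0 t := (hg j).mono_set (by
      rw [Set.uIcc_of_le ht.1, Set.uIcc_of_le hT0]; exact Set.Icc_subset_Icc le_rfl ht.2)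
    have i2 : IntervalIntegrable (g j) volume 0 u := (hg j).mono_set (by
      rw [Set.uIcc_of_le hu.1, Set.uIcc_of_le hT0]; exact Set.Icc_subset_Icc le_rfl huT.2)
    have i3 : IntervalIntegrable (g j) volume u t := i2.symm.trans i1
    have e1 : f j t - f j u = ∫ τ in u..t, g j τ := by
      rw [hint j t ht, hint j u huT, ← intervalIntegral.integral_interval_sub_left i1 i2]; ring
    have e2 : ∫ τ in u..t, -(C * N τ) ≤ ∫ τ in u..t, g j τ := by
      rw [intervalIntegral.integral_of_le hu.2, intervalIntegral.integral_of_le hu.2]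
      refine setIntegral_mono_on_ae ?_ i3.1 measurableSet_Ioc ?_
      · exact ((continuous_const.mul hNc).neg.intervalIntegrable u t).1
      · have := (ae_restrict_iff' measurableSet_Ici).1 (hlow j)
        filter_upwards [this] with τ hτ hmem
        have hτ0 : 0 ≤ τ := hu.1.trans hmem.1.le
        rw [hNe τ hτ0]
        exact hτ hτ0 (hmem.2.trans ht.2) (hneg τ hmem)
    rw [intervalIntegral.integral_neg, intervalIntegral.integral_const_mul] at e2
    have e3 : ∫ τ in (0:ℝ)..t, N τ = (∫ τ in (0:ℝ)..u, N τ) + ∫ τ in u..t, N τ :=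
      (intervalIntegral.integral_add_adjacent_intervals (hNc.intervalIntegrable _ _)
        (hNc.intervalIntegrable _ _)).symm
    have := mul_nonneg hC (hpos u hu.1)
    rw [e3, mul_add]
    linarith
  have hz := gron_zero N hNc hN0 T (Fintype.card ι * C) (fun t ht => by
    rw [hNe t ht.1]
    calc ∑ k, max (-f k t) 0 ≤ ∑ _k : ι, C * ∫ τ in (0:ℝ)..t, N τ :=
          Finset.sum_le_sum fun k _ => step k t ht
      _ = _ := by simp [mul_assoc])
  intro j t ht
  have h1 := hz t ht
  rw [hNe t ht.1] at h1
  have h2 := Finset.single_le_sum (f := fun k => max (-f k t) 0)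
    (fun k _ => le_max_right _ _) (Finset.mem_univ j)
  have h3 := le_max_left (-f j t) 0
  linarith

/-- Measurable essentially bounded times continuous is interval integrable. -/
theorem bdd_mul_int (b c : ℝ → ℝ) (hb : Measurable b) (C : ℝ)
    (hbC : ∀ᵐ t ∂(volume.restrict (Set.Ici (0:ℝ))), |b t| ≤ C)
    (hc : ContinuousOn c (Set.Ici 0)) (T : ℝ) (hT : 0 ≤ T) :
    IntervalIntegrable (fun t => b t * c t) volume 0 T := by
  refine IntervalIntegrable.mul_continuousOn ?_ (hc.mono ?_)
  · rw [intervalIntegrable_iff_integrableOn_Ioc_of_le hT]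
    refine Measure.integrableOn_of_bounded (M := C) (by simp) hb.aestronglyMeasurable ?_
    exact ae_mono (Measure.restrict_mono (fun x hx => hx.1.le) le_rfl) hbC
  · rw [Set.uIcc_of_le hT]; exact Set.Icc_subset_Ici_self

/-- a priori bounds (maximum principle) for the graph SIR system. -/
theorem graphSIR_bounds
    (n : ℕ) (hn : 1 ≤ n)
    (β γ : Fin n → ℝ → ℝ) (A : Fin n → Fin n → ℝ → ℝ)
    (hβm : ∀ j, Measurable (β j)) (hγm : ∀ j, Measurable (γ j))
    (hAm : ∀ j k, Measurable (A j k))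
    (hβb : ∀ j, ∃ C : ℝ, ∀ᵐ t ∂(volume.restrict (Set.Ici (0:ℝ))), |β j t| ≤ C)
    (hγb : ∀ j, ∃ C : ℝ, ∀ᵐ t ∂(volume.restrict (Set.Ici (0:ℝ))), |γ j t| ≤ C)
    (hAb : ∀ j k, ∃ C : ℝ, ∀ᵐ t ∂(volume.restrict (Set.Ici (0:ℝ))), |A j k t| ≤ C)
    (hβ0 : ∀ j, ∀ᵐ t ∂(volume.restrict (Set.Ici (0:ℝ))), 0 ≤ β j t)
    (hγ0 : ∀ j, ∀ᵐ t ∂(volume.restrict (Set.Ici (0:ℝ))), 0 ≤ γ j t)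
    (hA0 : ∀ j k, ∀ᵐ t ∂(volume.restrict (Set.Ici (0:ℝ))), 0 ≤ A j k t)
    (s0 i0 r0 : Fin n → ℝ)
    (hinit : ∀ j, 0 ≤ s0 j ∧ s0 j ≤ 1 ∧ 0 ≤ i0 j ∧ i0 j ≤ 1 ∧ 0 ≤ r0 j ∧ r0 j ≤ 1 ∧
      s0 j + i0 j + r0 j = 1)
    (s i r : Fin n → ℝ → ℝ)
    (hsol : IsGraphSIRSol n (Set.Ici 0) β γ A s i r)
    (hsol0 : ∀ j, s j 0 = s0 j ∧ i j 0 = i0 j ∧ r j 0 = r0 j) :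
    ∀ j : Fin n, ∀ t ∈ Set.Ici (0:ℝ),
      0 ≤ s j t ∧ s j t ≤ 1 ∧ 0 ≤ i j t ∧ i j t ≤ 1 ∧ 0 ≤ r j t ∧ r j t ≤ 1 ∧
      s j t + i j t + r j t = 1 := by
  obtain ⟨hcont, heq⟩ := hsol
  choose Cb hCb using hβb
  choose Cg hCg using hγb
  choose Ca hCa using hAb
  have hinv0 : (0:ℝ) ≤ 1 / (n:ℝ) := by positivity
  have hinv1 : 1 / (n:ℝ) ≤ 1 := by
    rw [div_le_one (by exact_mod_cast hn)]; exact_mod_cast hn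
  -- uniform bound on the products of coefficients
  set B : ℝ := ∑ j, ∑ k, |Cb k| * |Ca j k| with hB
  have hBle : ∀ j k, |Cb k| * |Ca j k| ≤ B := by
    intro j k
    have h1 := Finset.single_le_sum (f := fun k => |Cb k| * |Ca j k|)
      (fun k _ => by positivity) (Finset.mem_univ k)
    have h2 := Finset.single_le_sum (f := fun j => ∑ k, |Cb k| * |Ca j k|)
      (fun j _ => by positivity) (Finset.mem_univ j)
    exact h1.trans h2
  have hB0 : 0 ≤ B := by positivity
  have hprod : ∀ j k, ∀ᵐ t ∂(volume.restrict (Set.Ici (0:ℝ))),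
      |β k t * A j k t| ≤ B := by
    intro j k
    filter_upwards [hCb k, hCa j k] with t h1 h2
    rw [abs_mul]
    refine le_trans ?_ (hBle j k)
    exact mul_le_mul (h1.trans (le_abs_self _)) (h2.trans (le_abs_self _)) (abs_nonneg _)
      (abs_nonneg _)
  have hprod' : ∀ j, ∀ᵐ t ∂(volume.restrict (Set.Ici (0:ℝ))),
      ∀ k, |β k t * A j k t| ≤ B := fun j => ae_all_iff.2 (hprod j)
  have hprod0 : ∀ j, ∀ᵐ t ∂(volume.restrict (Set.Ici (0:ℝ))),
      ∀ k, 0 ≤ β k t * A j k t := fun j => ae_all_iff.2 (fun k => by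
    filter_upwards [hβ0 k, hA0 j k] with t h1 h2 using mul_nonneg h1 h2)
  -- integrability
  have hI1 : ∀ T, 0 ≤ T → ∀ j, IntervalIntegrable (fun τ =>
      s j τ * (1 / (n : ℝ) * ∑ k : Fin n, β k τ * A j k τ * i k τ)) volume 0 T := by
    intro T hT j
    have : IntervalIntegrable (fun τ =>
      ∑ k : Fin n, (β k τ * A j k τ) * (s j τ * (1 / (n : ℝ)) * i k τ)) volume 0 T := by
      have := IntervalIntegrable.sum (μ := volume) (a := 0) (b := T) Finset.univ
        (f := fun k τ => (β k τ * A j k τ) * (s j τ * (1 / (n : ℝ)) * i k τ))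
        (fun k _ => bdd_mul_int _ _ ((hβm k).mul (hAm j k)) B (hprod j k)
          (((hcont j).1.mul continuousOn_const).mul (hcont k).2.1) T hT)
      have e : (fun τ => ∑ k : Fin n, (β k τ * A j k τ) * (s j τ * (1 / (n : ℝ)) * i k τ)) =
          ∑ k : Fin n, (fun τ => (β k τ * A j k τ) * (s j τ * (1 / (n : ℝ)) * i k τ)) := by
        funext τ; simp
      rw [e]; exact this
    convert this using 2 with τ
    rw [Finset.mul_sum, Finset.mul_sum]
    exact Finset.sum_congr rfl fun k _ => by ring
  have hI2 : ∀ T, 0 ≤ T → ∀ j, IntervalIntegrable (fun τ => γ j τ * i j τ) volume 0 T :=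
    fun T hT j => bdd_mul_int _ _ (hγm j) (Cg j) (hCg j) (hcont j).2.1 T hT
  -- continuous functions are bounded on compact intervals
  have hbd : ∀ (f : Fin n → ℝ → ℝ), (∀ j, ContinuousOn (f j) (Set.Ici 0)) → ∀ T : ℝ,
      ∃ M : ℝ, 0 ≤ M ∧ ∀ j, ∀ t ∈ Set.Icc 0 T, |f j t| ≤ M := by
    intro f hf T
    have : ∀ j, ∃ C, ∀ t ∈ Set.Icc 0 T, ‖f j t‖ ≤ C := fun j =>
      isCompact_Icc.exists_bound_of_continuousOn ((hf j).mono Set.Icc_subset_Ici_self)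
    choose C hC using this
    refine ⟨∑ j, |C j|, by positivity, fun j t ht => ?_⟩
    have h2 := Finset.single_le_sum (f := fun j => |C j|)
      (fun j _ => by positivity) (Finset.mem_univ j)
    exact ((hC j t ht).trans (le_abs_self _)).trans h2
  -- nonnegativity of s
  have hs : ∀ j, ∀ T, 0 ≤ T → 0 ≤ s j T := by
    intro j T hT
    obtain ⟨M, hM0, hM⟩ := hbd i (fun j => (hcont j).2.1) T
    refine quasi_pos (ι := Unit) (fun _ => s j) (fun _ τ =>
      -(s j τ * (1 / (n : ℝ) * ∑ k : Fin n, β k τ * A j k τ * i k τ))) T (n * (B * M))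
      (by positivity) (fun _ => (hcont j).1) (fun _ => (hI1 T hT j).neg) ?_ ?_ ?_ () T ⟨hT, le_rfl⟩
    · intro _ t ht
      rw [intervalIntegral.integral_neg, ← sub_eq_add_neg]
      exact (heq j t ht.1).1
    · intro _
      rw [(hsol0 j).1]; exact (hinit j).1
    · intro _
      filter_upwards [hprod' j, ae_restrict_mem measurableSet_Ici] with τ h1 hτ0 hτT hneg
      have hτ : τ ∈ Set.Icc 0 T := ⟨hτ0, hτT⟩
      have h2 : |∑ k : Fin n, β k τ * A j k τ * i k τ| ≤ n * (B * M) := by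
        refine (Finset.abs_sum_le_sum_abs _ _).trans ?_
        calc _ ≤ ∑ _k : Fin n, B * M := Finset.sum_le_sum fun k _ => by
              rw [abs_mul]
              exact mul_le_mul (h1 k) (hM k τ hτ) (abs_nonneg _) hB0
          _ = _ := by simp
      have h3 : |1 / (n:ℝ) * ∑ k : Fin n, β k τ * A j k τ * i k τ| ≤ n * (B * M) := by
        rw [abs_mul, abs_of_nonneg hinv0]
        exact (mul_le_of_le_one_left (abs_nonneg _) hinv1).trans h2
      have h4 := (abs_le.1 h3).1
      simp only [Finset.univ_unique, Finset.sum_const, Finset.card_singleton, one_smul]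
      rw [max_eq_left (by linarith)]
      nlinarith
  -- nonnegativity of i
  have hi : ∀ j, ∀ T, 0 ≤ T → 0 ≤ i j T := by
    intro j T hT
    obtain ⟨S, hS0, hS⟩ := hbd s (fun j => (hcont j).1) T
    refine quasi_pos i (fun j τ =>
      s j τ * (1 / (n : ℝ) * ∑ k : Fin n, β k τ * A j k τ * i k τ) - γ j τ * i j τ) T (S * B)
      (by positivity) (fun j => (hcont j).2.1) (fun j => (hI1 T hT j).sub (hI2 T hT j))
      (fun j t ht => (heq j t ht.1).2.1) ?_ ?_ j T ⟨hT, le_rfl⟩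
    · intro j
      rw [(hsol0 j).2.1]; exact (hinit j).2.2.1
    · intro j
      filter_upwards [hprod' j, hprod0 j, hγ0 j, ae_restrict_mem measurableSet_Ici]
        with τ h1 h1' hg hτ0 hτT hneg
      have hτ : τ ∈ Set.Icc 0 T := ⟨hτ0, hτT⟩
      set P := ∑ k, max (-i k τ) 0 with hP
      have hP0 : 0 ≤ P := Finset.sum_nonneg fun k _ => le_max_right _ _
      have h2 : -(B * P) ≤ ∑ k : Fin n, β k τ * A j k τ * i k τ := by
        rw [hP, Finset.mul_sum, ← Finset.sum_neg_distrib]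
        refine Finset.sum_le_sum fun k _ => ?_
        have a1 := le_max_left (-i k τ) 0
        have a2 := le_max_right (-i k τ) 0
        have a3 := (abs_le.1 (h1 k)).2
        have a4 := mul_le_mul_of_nonneg_right a3 a2
        have a5 := mul_le_mul_of_nonneg_left a1 (h1' k)
        linarith
      have hBP : 0 ≤ B * P := mul_nonneg hB0 hP0
      have h3 : -(B * P) ≤ 1 / (n:ℝ) * ∑ k : Fin n, β k τ * A j k τ * i k τ := by
        have b1 := mul_le_mul_of_nonneg_left h2 hinv0
        have b2 := mul_le_mul_of_nonneg_right hinv1 hBP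
        linarith
      have hs0 := hs j τ hτ0
      have hsS := (abs_le.1 (hS j τ hτ)).2
      have c1 := mul_le_mul_of_nonneg_left h3 hs0
      have c2 := mul_le_mul_of_nonneg_right hsS hBP
      have c3 := mul_nonneg hg (neg_nonneg.2 hneg.le)
      linarith
  -- nonnegativity of r
  have hr : ∀ j, ∀ T, 0 ≤ T → 0 ≤ r j T := by
    intro j T hT
    rw [(heq j T hT).2.2, (hsol0 j).2.2]
    refine add_nonneg (hinit j).2.2.2.2.1 ?_
    rw [intervalIntegral.integral_of_le hT]
    refine setIntegral_nonneg_of_ae_restrict ?_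
    have := ae_mono (Measure.restrict_mono
      (fun x (hx : x ∈ Set.Ioc 0 T) => (hx.1.le : x ∈ Set.Ici (0:ℝ))) le_rfl) (hγ0 j)
    filter_upwards [this, ae_restrict_mem measurableSet_Ioc] with τ h1 h2
    exact mul_nonneg h1 (hi j τ h2.1.le)
  intro j t ht
  have ht0 : (0:ℝ) ≤ t := ht
  have hsum : s j t + i j t + r j t = 1 := by
    obtain ⟨e1, e2, e3⟩ := heq j t ht
    rw [intervalIntegral.integral_sub (hI1 t ht0 j) (hI2 t ht0 j)] at e2
    obtain ⟨q1, q2, q3⟩ := hsol0 j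
    have := (hinit j).2.2.2.2.2.2
    linarith
  have a := hs j t ht0
  have b := hi j t ht0
  have c := hr j t ht0
  exact ⟨a, by linarith, b, by linarith, c, by linarith, hsum⟩

end
end
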